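/- arXiv:1602.06607 — 2 statements merged into one kernel-verified Lean document; each statement's English description precedes it below -/
import Mathlib

section
/- Assume nd ≥ 2n+4 and let m be an integer with −1 ≤ m ≤ n/2. Regarding the period matrices [P_{i+j}] and [(P̌_m)_{i+j}] as linear maps ℂ^{I_d} → ℂ^{I_{(n/2)d−n−2}}, the codimension in ℂ^{I_d} of ker[P_{i+j}] ∩ ker[(P̌_m)_{i+j}] equals K^d_n(m) := 2·C_{1^{n/2+1},(d−1)^{n/2+1}} − C_{1^{n−m+1},(d−1)^{m+1}}. In particular, for m = −1 the two kernels intersect transversely: the codimension of their intersection equals the sum of the ranks of the two period matrices. -/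
open Finset Matrix

/-- `ζ_{2d} = exp(2πi/(2d))`. -/
noncomputable def zeta2d (d : ℕ) : ℂ :=
  Complex.exp (2 * Real.pi * Complex.I / (2 * (d : ℂ)))

/-- The even-position index `2e` in `{0,…,n+1}` (with `n = 2h`). -/
def evIdx (h : ℕ) (e : Fin (h + 1)) : Fin (2 * h + 2) :=
  ⟨2 * e.1, by have := e.isLt; omega⟩

/-- The odd-position index `2e+1` in `{0,…,n+1}` (with `n = 2h`). -/
def odIdx (h : ℕ) (e : Fin (h + 1)) : Fin (2 * h + 2) :=
  ⟨2 * e.1 + 1, by have := e.isLt; omega⟩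

/-- The index set `I_N`: tuples `(i_0,…,i_{n+1})` with `0 ≤ i_e ≤ d-2` and `∑ i_e = N`,
for `n = 2h` even. -/
abbrev IdxSet (h d N : ℕ) : Type :=
  {i : Fin (2 * h + 2) → Fin (d - 1) // ∑ e, (i e).1 = N}

/-- The period vector `p^{a,b}` of the linear cycle `ℙ^{n/2}_{a,b}` in the Fermat variety,
extended by zero to all integer tuples. -/
noncomputable def pvec (h d : ℕ) (a : Fin (h + 1) → ℕ) (b : Equiv.Perm (Fin (2 * h + 2)))
    (i : Fin (2 * h + 2) → ℕ) : ℂ :=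
  if ∀ e : Fin (h + 1), i (b (evIdx h e)) + i (b (odIdx h e)) = d - 2 then
    zeta2d d ^ (∑ e : Fin (h + 1), (i (b (evIdx h e)) + 1) * (1 + 2 * a e))
  else 0

/-- The period matrix `[p_{i+j}]` with rows indexed by `I_{(n/2)d-n-2}` and columns by `I_d`. -/
noncomputable def pmat (h d : ℕ) (p : (Fin (2 * h + 2) → ℕ) → ℂ) :
    Matrix (IdxSet h d (h * d - (2 * h + 2))) (IdxSet h d d) ℂ :=
  Matrix.of fun i j => p fun e => (i.1 e).1 + (j.1 e).1

/-- The period vector `P` of the linear cycle with `a = (0,…,0)` and `b = id`. -/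
noncomputable def Pvec (h d : ℕ) : (Fin (2 * h + 2) → ℕ) → ℂ :=
  pvec h d (fun _ => 0) (Equiv.refl _)

/-- The period vector `P̌_m` (with `μ = m+1`): `a` has first `μ` entries `0`, the rest `1`,
and `b = id`. -/
noncomputable def PcheckVec (h d μ : ℕ) : (Fin (2 * h + 2) → ℕ) → ℂ :=
  pvec h d (fun e => if e.1 < μ then 0 else 1) (Equiv.refl _)

/-- The combinatorial constant `C_{α_1,…,α_s}`. -/
def Ccoef (n d : ℕ) {s : ℕ} (α : Fin s → ℕ) : ℤ :=
  ((n + 1 + d).choose (n + 1) : ℤ) -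
    ∑ k ∈ Finset.Icc 1 s, (-1 : ℤ) ^ (k - 1) *
      ∑ T ∈ Finset.univ.filter (fun T : Finset (Fin s) => T.card = k ∧ ∑ i ∈ T, α i ≤ d),
        (((n + 1 + d - ∑ i ∈ T, α i).choose (n + 1) : ℤ))

/-- The sequence `x^s, y^t` (x repeated s times followed by y repeated t times). -/
def twoBlock (x y s t : ℕ) : Fin (s + t) → ℕ := fun i => if i.1 < s then x else y

/-- `K^d_n(m) = 2·C_{1^{n/2+1},(d-1)^{n/2+1}} − C_{1^{n−m+1},(d−1)^{m+1}}`, with `n = 2h`,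
`μ = m+1`. -/
def Kdef (h d μ : ℕ) : ℤ :=
  2 * Ccoef (2 * h) d (twoBlock 1 (d - 1) (h + 1) (h + 1)) -
    Ccoef (2 * h) d (twoBlock 1 (d - 1) (2 * h + 2 - μ) μ)

/-! ### Counting tuples via power series -/

/-- Number of tuples in `{0,…,d-2}^t` with sum `d`. -/
def tupCount (d t : ℕ) : ℕ := Fintype.card {k : Fin t → Fin (d - 1) // ∑ e, (k e).1 = d}

lemma coeff_geom_pow (d t : ℕ) :
    PowerSeries.coeff d ((∑ i ∈ Finset.range (d - 1), (PowerSeries.X : PowerSeries ℤ) ^ i) ^ t)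
      = (tupCount d t : ℤ) := by
  have h1 : (∑ i ∈ Finset.range (d - 1), (PowerSeries.X : PowerSeries ℤ) ^ i) ^ t
      = ∑ k : Fin t → Fin (d - 1), (PowerSeries.X : PowerSeries ℤ) ^ (∑ e, (k e).1) := by
    rw [Finset.sum_range]
    have := Finset.prod_univ_sum (fun _ : Fin t => (Finset.univ : Finset (Fin (d - 1))))
      (fun _ i => (PowerSeries.X : PowerSeries ℤ) ^ i.1)
    rw [Fintype.piFinset_univ, Finset.prod_const, Finset.card_univ, Fintype.card_fin] at this
    rw [this]
    refine Finset.sum_congr rfl fun k _ => ?_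
    rw [Finset.prod_pow_eq_pow_sum]
  rw [h1, map_sum, tupCount, Fintype.card_subtype, Finset.card_filter]
  push_cast
  refine Finset.sum_congr rfl fun k _ => ?_
  rw [PowerSeries.coeff_X_pow]
  simp only [eq_comm]

lemma Ccoef_eq_coeff (n d : ℕ) {s : ℕ} (α : Fin s → ℕ) :
    Ccoef n d α = PowerSeries.coeff d
      ((∏ i, (1 - (PowerSeries.X : PowerSeries ℤ) ^ α i)) *
        (PowerSeries.invOneSubPow ℤ (n + 2)).val) := by
  have h1 : (∏ i, (1 - (PowerSeries.X : PowerSeries ℤ) ^ α i))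
      = ∑ T : Finset (Fin s), (-1) ^ T.card * (PowerSeries.X : PowerSeries ℤ) ^ (∑ i ∈ T, α i) := by
    have := Finset.prod_add (fun i => - (PowerSeries.X : PowerSeries ℤ) ^ α i) (fun _ => 1)
      Finset.univ
    simp only [Finset.prod_const_one, mul_one, Finset.powerset_univ] at this
    rw [show (∏ i, (1 - (PowerSeries.X : PowerSeries ℤ) ^ α i))
      = ∏ i, (-(PowerSeries.X : PowerSeries ℤ) ^ α i + 1) from
        Finset.prod_congr rfl fun i _ => by ring, this]
    refine Finset.sum_congr rfl fun T _ => ?_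
    rw [Finset.prod_neg, Finset.prod_pow_eq_pow_sum]
  set g : Finset (Fin s) → ℤ := fun T =>
    if ∑ i ∈ T, α i ≤ d then (-1) ^ T.card * ((n + 1 + d - ∑ i ∈ T, α i).choose (n + 1) : ℤ) else 0
    with hg
  have h2 : PowerSeries.coeff d
      ((∏ i, (1 - (PowerSeries.X : PowerSeries ℤ) ^ α i)) *
        (PowerSeries.invOneSubPow ℤ (n + 2)).val) = ∑ T, g T := by
    rw [h1, Finset.sum_mul, map_sum]
    refine Finset.sum_congr rfl fun T _ => ?_
    rw [show n + 2 = (n + 1) + 1 from rfl, PowerSeries.invOneSubPow_val_succ_eq_mk_add_choose,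
      mul_assoc]
    have : ((-1 : PowerSeries ℤ)) ^ T.card = PowerSeries.C ((-1 : ℤ) ^ T.card) := by simp
    rw [this, PowerSeries.coeff_C_mul, PowerSeries.coeff_X_pow_mul']
    simp only [hg]
    split_ifs with hle
    · rw [PowerSeries.coeff_mk, Nat.add_sub_assoc hle]
    · simp
  rw [h2]
  have h3 : ∑ T, g T = ∑ k ∈ Finset.range (s + 1), ∑ T with T.card = k, g T := by
    rw [Finset.sum_fiberwise_of_maps_to]
    intro T _
    have := Finset.card_le_univ T
    simp at this ⊢
    omega
  rw [h3, Finset.sum_range_succ', Ccoef, ← Finset.Ico_add_one_right_eq_Icc,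
    Finset.sum_Ico_eq_sum_range]
  have h4 : ∑ T : Finset (Fin s) with T.card = 0, g T = ((n + 1 + d).choose (n + 1) : ℤ) := by
    simp only [Finset.card_eq_zero]
    rw [Finset.sum_filter, Finset.sum_ite_eq' Finset.univ ∅]
    simp [hg]
  rw [h4, sub_eq_add_neg, add_comm, ← Finset.sum_neg_distrib]
  congr 1
  rw [show s + 1 - 1 = s by omega]
  refine Finset.sum_congr rfl fun k _ => ?_
  rw [Finset.mul_sum, ← Finset.sum_neg_distrib, Finset.filter_and]
  simp only [hg]
  rw [← Finset.sum_filter, Finset.filter_filter, ← Finset.filter_and]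
  refine Finset.sum_congr (by ext T; simp [add_comm]) fun T hT => ?_
  simp only [Finset.mem_filter, Finset.mem_univ, true_and] at hT
  rw [hT.1, show 1 + k - 1 = k by omega, add_comm, pow_succ]
  ring

lemma Ccoef_twoBlock (h d s t : ℕ) (hst : s + t = 2 * h + 2) :
    Ccoef (2 * h) d (twoBlock 1 (d - 1) s t) = (tupCount d t : ℤ) := by
  rw [Ccoef_eq_coeff, ← coeff_geom_pow, Fin.prod_univ_add]
  have e1 : ∀ i : Fin s, twoBlock 1 (d - 1) s t (Fin.castAdd t i) = 1 := fun i => by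
    simp [twoBlock]
  have e2 : ∀ i : Fin t, twoBlock 1 (d - 1) s t (Fin.natAdd s i) = d - 1 := fun i => by
    simp [twoBlock]
  simp only [e1, e2, pow_one, Finset.prod_const, Finset.card_univ, Fintype.card_fin]
  rw [← geom_sum_mul_neg, mul_pow]
  congr 1
  have e3 : (1 - (PowerSeries.X : PowerSeries ℤ)) ^ (2 * h + 2) *
      (PowerSeries.invOneSubPow ℤ (2 * h + 2)).val = 1 := by
    rw [← PowerSeries.invOneSubPow_inv_eq_one_sub_pow]
    exact (PowerSeries.invOneSubPow ℤ (2 * h + 2)).inv_val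
  rw [← hst, pow_add] at e3
  rw [← hst]
  linear_combination (∑ i ∈ Finset.range (d - 1), (PowerSeries.X : PowerSeries ℤ) ^ i) ^ t * e3

lemma card_zero_tail (d N μ : ℕ) (hd : 3 ≤ d) (hμ : μ ≤ N) :
    Fintype.card {k : {k : Fin N → Fin (d - 1) // ∑ e, (k e).1 = d} //
      ¬ ∃ e, μ ≤ e.1 ∧ (k.1 e).1 ≠ 0} = tupCount d μ := by
  obtain ⟨r, rfl⟩ := Nat.exists_eq_add_of_le hμ
  rw [tupCount]
  refine Fintype.card_congr
    { toFun := fun k => ⟨fun e => k.1.1 (Fin.castAdd r e), ?_⟩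
      invFun := fun k => ⟨⟨Fin.addCases (motive := fun _ => Fin (d - 1)) k.1
        (fun _ => ⟨0, by omega⟩), ?_⟩, ?_⟩
      left_inv := ?_
      right_inv := ?_ }
  · have h1 := k.1.2
    have h2 := k.2
    push Not at h2
    rw [Fin.sum_univ_add] at h1
    have h3 : ∑ i : Fin r, (k.1.1 (Fin.natAdd μ i)).1 = 0 :=
      Finset.sum_eq_zero fun i _ => h2 _ (by simp)
    rw [h3, add_zero] at h1
    exact h1
  · rw [Fin.sum_univ_add]
    simpa using k.2
  · rintro ⟨e, he, h0⟩
    induction e using Fin.addCases with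
    | left e => simp at he; omega
    | right e => simp at h0
  · rintro ⟨⟨k, hk⟩, h2⟩
    push Not at h2
    ext e
    induction e using Fin.addCases with
    | left e => simp
    | right e => simpa using (h2 (Fin.natAdd μ e) (by simp)).symm
  · rintro ⟨k, hk⟩
    ext e
    simp

/-! ### Reduction of the kernels to evaluations on pairs of variables -/

lemma sum_pairs (h : ℕ) (f : Fin (2 * h + 2) → ℕ) :
    ∑ i, f i = ∑ e, (f (evIdx h e) + f (odIdx h e)) := by
  rw [Finset.sum_add_distrib]
  have hb : Function.Bijective (Sum.elim (evIdx h) (odIdx h)) := by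
    constructor
    · rintro (a | a) (b | b) hab <;>
        simp only [Sum.elim_inl, Sum.elim_inr, evIdx, odIdx, Fin.mk.injEq] at hab
      · congr 1; ext; omega
      · omega
      · omega
      · congr 1; ext; omega
    · intro i
      rcases Nat.even_or_odd' i.1 with ⟨c, hc | hc⟩
      · exact ⟨Sum.inl ⟨c, by omega⟩, by ext; simp [evIdx, hc]⟩
      · exact ⟨Sum.inr ⟨c, by omega⟩, by ext; simp [odIdx, hc]⟩
  rw [← Fintype.sum_bijective _ hb (fun x => f (Sum.elim (evIdx h) (odIdx h) x)) f
    (fun _ => rfl), Fintype.sum_sum_type]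
  simp

/-- The tuple with prescribed even and odd entries. -/
def pairT {β : Type} (h : ℕ) (u v : Fin (h + 1) → β) : Fin (2 * h + 2) → β := fun i =>
  if i.1 % 2 = 0 then u ⟨i.1 / 2, by omega⟩ else v ⟨i.1 / 2, by omega⟩

lemma pairT_ev {β : Type} (h : ℕ) (u v : Fin (h + 1) → β) (e : Fin (h + 1)) :
    pairT h u v (evIdx h e) = u e := by
  simp [pairT, evIdx]

lemma pairT_od {β : Type} (h : ℕ) (u v : Fin (h + 1) → β) (e : Fin (h + 1)) :
    pairT h u v (odIdx h e) = v e := by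
  have h1 : (2 * e.1 + 1) % 2 = 1 := by omega
  have h2 : (2 * e.1 + 1) / 2 = e.1 := by omega
  simp [pairT, odIdx, h1, h2]

/-- Exponents of degree `d` monomials in `h+1` variables, truncated at `d-2`. -/
abbrev ASet (h d : ℕ) : Type := {k : Fin (h + 1) → Fin (d - 1) // ∑ e, (k e).1 = d}

/-- Matrix of the evaluation `x_{2e} = ω_e x_{2e+1}`. -/
noncomputable def nmat (h d : ℕ) (a : Fin (h + 1) → ℕ) : Matrix (ASet h d) (IdxSet h d d) ℂ :=
  Matrix.of fun k j => if ∀ e, (j.1 (evIdx h e)).1 + (j.1 (odIdx h e)).1 = (k.1 e).1 then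
    zeta2d d ^ (∑ e, (j.1 (evIdx h e)).1 * (1 + 2 * a e)) else 0

lemma zeta_ne (d : ℕ) : zeta2d d ≠ 0 := Complex.exp_ne_zero _

lemma pmat_def (h d : ℕ) (a : Fin (h + 1) → ℕ)
    (i : IdxSet h d (h * d - (2 * h + 2))) (j : IdxSet h d d) :
    pmat h d (pvec h d a (Equiv.refl _)) i j =
      if ∀ e : Fin (h + 1), ((i.1 (evIdx h e)).1 + (j.1 (evIdx h e)).1) +
        ((i.1 (odIdx h e)).1 + (j.1 (odIdx h e)).1) = d - 2 then
      zeta2d d ^ (∑ e, ((i.1 (evIdx h e)).1 + (j.1 (evIdx h e)).1 + 1) * (1 + 2 * a e))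
      else 0 := rfl

lemma pmat_entry (h d : ℕ) (a : Fin (h + 1) → ℕ)
    (i : IdxSet h d (h * d - (2 * h + 2))) (j : IdxSet h d d) (k : ASet h d)
    (hk : ∀ e, (i.1 (evIdx h e)).1 + (i.1 (odIdx h e)).1 + (k.1 e).1 = d - 2) :
    pmat h d (pvec h d a (Equiv.refl _)) i j
      = zeta2d d ^ (∑ e, ((i.1 (evIdx h e)).1 + 1) * (1 + 2 * a e)) * nmat h d a k j := by
  rw [pmat_def]
  simp only [nmat, Matrix.of_apply]
  by_cases hc : ∀ e, (j.1 (evIdx h e)).1 + (j.1 (odIdx h e)).1 = (k.1 e).1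
  · rw [if_pos hc, if_pos (fun e => by have := hc e; have := hk e; omega), ← pow_add,
      ← Finset.sum_add_distrib]
    congr 1
    exact Finset.sum_congr rfl fun e _ => by ring
  · rw [if_neg hc, if_neg (fun hx => hc fun e => by have := hx e; have := hk e; omega), mul_zero]

lemma ker_pmat (h d : ℕ) (hd : 3 ≤ d) (hhd : 2 * h + 2 ≤ h * d) (a : Fin (h + 1) → ℕ) :
    LinearMap.ker (pmat h d (pvec h d a (Equiv.refl _))).mulVecLin
      = LinearMap.ker (nmat h d a).mulVecLin := by
  have key : ∀ (i : IdxSet h d (h * d - (2 * h + 2))) (k : ASet h d) (f : IdxSet h d d → ℂ)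
    (_ : ∀ e, (i.1 (evIdx h e)).1 + (i.1 (odIdx h e)).1 + (k.1 e).1 = d - 2),
    (pmat h d (pvec h d a (Equiv.refl _)) *ᵥ f) i
      = zeta2d d ^ (∑ e, ((i.1 (evIdx h e)).1 + 1) * (1 + 2 * a e)) * (nmat h d a *ᵥ f) k := by
    intro i k f hk
    simp only [Matrix.mulVec, dotProduct, Finset.mul_sum]
    refine Finset.sum_congr rfl fun j _ => ?_
    rw [pmat_entry h d a i j k hk, mul_assoc]
  obtain ⟨c, rfl⟩ := Nat.exists_eq_add_of_le hd
  have hsz : (h + 1) * (3 + c - 2) = h * (3 + c) - (2 * h + 2) + (3 + c) := by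
    rw [show 3 + c - 2 = 1 + c by omega]
    have : h * (3 + c) = 2 * h + (h * (1 + c)) := by ring
    rw [add_mul]; omega
  have hconst : ∑ _e : Fin (h + 1), (3 + c - 2) = (h + 1) * (3 + c - 2) := by simp
  ext f
  rw [LinearMap.mem_ker, LinearMap.mem_ker, Matrix.mulVecLin_apply, Matrix.mulVecLin_apply]
  constructor
  · intro hf
    ext k
    let i0 : Fin (2 * h + 2) → Fin (3 + c - 1) :=
      pairT h (fun _ => ⟨0, by omega⟩) (fun e => ⟨3 + c - 2 - (k.1 e).1, by omega⟩)
    have hk : ∀ e, (i0 (evIdx h e)).1 + (i0 (odIdx h e)).1 + (k.1 e).1 = 3 + c - 2 := by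
      intro e
      simp only [i0, pairT_ev, pairT_od]
      have := (k.1 e).2
      omega
    have hs : ∑ e, (i0 e).1 = h * (3 + c) - (2 * h + 2) := by
      rw [sum_pairs h (fun e => (i0 e).1)]
      have h1 := Finset.sum_congr rfl fun e (_ : e ∈ Finset.univ) => hk e
      rw [Finset.sum_add_distrib, k.2, hconst, hsz] at h1
      omega
    have h2 := key ⟨i0, hs⟩ k f hk
    rw [hf] at h2
    simp only [Pi.zero_apply] at h2 ⊢
    exact (mul_eq_zero.mp h2.symm).resolve_left (pow_ne_zero _ (zeta_ne _))
  · intro hf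
    ext i
    by_cases hle : ∀ e, (i.1 (evIdx h e)).1 + (i.1 (odIdx h e)).1 ≤ 3 + c - 2
    · let k0 : Fin (h + 1) → Fin (3 + c - 1) := fun e =>
        ⟨3 + c - 2 - ((i.1 (evIdx h e)).1 + (i.1 (odIdx h e)).1), by omega⟩
      have hk : ∀ e, (i.1 (evIdx h e)).1 + (i.1 (odIdx h e)).1 + (k0 e).1 = 3 + c - 2 := by
        intro e
        have := hle e
        simp only [k0]
        omega
      have hs : ∑ e, (k0 e).1 = 3 + c := by
        have h1 := Finset.sum_congr rfl fun e (_ : e ∈ Finset.univ) => hk e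
        rw [Finset.sum_add_distrib, ← sum_pairs h (fun e => (i.1 e).1), i.2, hconst, hsz] at h1
        omega
      rw [key i ⟨k0, hs⟩ f hk, hf]
      simp
    · simp only [Matrix.mulVec, dotProduct, Pi.zero_apply]
      refine Finset.sum_eq_zero fun j _ => ?_
      rw [pmat_def, if_neg (fun hx => hle fun e => by have := hx e; omega), zero_mul]

lemma finrank_quot_ker {m n : Type} [Fintype m] [Fintype n] (M : Matrix m n ℂ) :
    Module.finrank ℂ ((n → ℂ) ⧸ LinearMap.ker M.mulVecLin) = M.rank := by
  rw [Matrix.rank]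
  exact LinearEquiv.finrank_eq M.mulVecLin.quotKerEquivRange

/-- The monomial `∏ x_{2e+1}^{k_e}`, shifted by moving `u_e` factors to `x_{2e}`. -/
def liftIdx (h d : ℕ) (k : ASet h d) (u : Fin (h + 1) → ℕ) (hu : ∀ e, u e ≤ (k.1 e).1) :
    IdxSet h d d :=
  ⟨pairT h (fun e => ⟨u e, by have := hu e; omega⟩) (fun e => ⟨(k.1 e).1 - u e, by omega⟩), by
    rw [sum_pairs h (fun e => (pairT h _ _ e : Fin (d - 1)).1)]
    simp only [pairT_ev, pairT_od]
    refine Eq.trans (Finset.sum_congr rfl fun e _ => ?_) k.2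
    have := hu e
    omega⟩

lemma nmat_liftIdx (h d : ℕ) (a : Fin (h + 1) → ℕ) (k k' : ASet h d) (u : Fin (h + 1) → ℕ)
    (hu : ∀ e, u e ≤ (k.1 e).1) :
    nmat h d a k' (liftIdx h d k u hu)
      = if k' = k then zeta2d d ^ (∑ e, u e * (1 + 2 * a e)) else 0 := by
  simp only [nmat, Matrix.of_apply, liftIdx, pairT_ev, pairT_od]
  have : (∀ e, u e + ((k.1 e).1 - u e) = (k'.1 e).1) ↔ k' = k := by
    constructor
    · intro hx
      ext e
      have := hx e
      have := hu e
      omega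
    · rintro rfl e
      have := hu e
      omega
  simp only [this]

lemma rank_nmat (h d : ℕ) (a : Fin (h + 1) → ℕ) : (nmat h d a).rank = tupCount d (h + 1) := by
  rw [LinearIndependent.rank_matrix, tupCount]
  rw [Fintype.linearIndependent_iff]
  intro g hg k
  have := congrFun hg (liftIdx h d k (fun _ => 0) (fun _ => Nat.zero_le _))
  simpa [Matrix.row, nmat_liftIdx] using this

/-- Exponents involving one of the variables with index at least `μ`. -/
abbrev BSet (h d μ : ℕ) : Type := {k : ASet h d // ∃ e, μ ≤ e.1 ∧ (k.1 e).1 ≠ 0}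

/-- The second tuple `a`. -/
def aμ (h μ : ℕ) : Fin (h + 1) → ℕ := fun e => if e.1 < μ then 0 else 1

/-- The combined evaluation matrix. -/
noncomputable def cmat (h d μ : ℕ) : Matrix (ASet h d ⊕ BSet h d μ) (IdxSet h d d) ℂ :=
  Matrix.of (Sum.elim (fun k => nmat h d (fun _ => 0) k) (fun k => nmat h d (aμ h μ) k.1))

lemma ker_cmat (h d μ : ℕ) :
    LinearMap.ker (nmat h d (fun _ => 0)).mulVecLin ⊓ LinearMap.ker (nmat h d (aμ h μ)).mulVecLin
      = LinearMap.ker (cmat h d μ).mulVecLin := by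
  ext f
  rw [Submodule.mem_inf, LinearMap.mem_ker, LinearMap.mem_ker, LinearMap.mem_ker,
    Matrix.mulVecLin_apply, Matrix.mulVecLin_apply, Matrix.mulVecLin_apply]
  constructor
  · rintro ⟨h1, h2⟩
    ext (k | k)
    · exact congrFun h1 k
    · exact congrFun h2 k.1
  · intro hf
    have h1 : ∀ k, (nmat h d (fun _ => 0) *ᵥ f) k = 0 := fun k => congrFun hf (Sum.inl k)
    refine ⟨funext h1, ?_⟩
    ext k
    by_cases hk : ∃ e, μ ≤ e.1 ∧ (k.1 e).1 ≠ 0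
    · exact congrFun hf (Sum.inr ⟨k, hk⟩)
    · rw [Pi.zero_apply, ← h1 k]
      simp only [Matrix.mulVec, dotProduct]
      refine Finset.sum_congr rfl fun j _ => ?_
      congr 1
      simp only [nmat, Matrix.of_apply]
      split_ifs with hc
      · congr 1
        refine Finset.sum_congr rfl fun e _ => ?_
        push Not at hk
        by_cases he : e.1 < μ
        · simp [aμ, he]
        · have := hc e
          have := hk e (by omega)
          rw [show (j.1 (evIdx h e)).1 = 0 by omega, zero_mul, zero_mul]
      · rfl

lemma zeta_sq_ne (d : ℕ) (hd : 3 ≤ d) : zeta2d d ^ 2 ≠ 1 := by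
  have hp : IsPrimitiveRoot (zeta2d d) (2 * d) := by
    have := Complex.isPrimitiveRoot_exp (2 * d) (by omega)
    simpa [zeta2d] using this
  exact hp.pow_ne_one_of_pos_of_lt (by omega) (by omega)

lemma rank_cmat (h d μ : ℕ) (hd : 3 ≤ d) :
    (cmat h d μ).rank = tupCount d (h + 1) + Fintype.card (BSet h d μ) := by
  rw [LinearIndependent.rank_matrix, Fintype.card_sum, tupCount]
  rw [Fintype.linearIndependent_iff]
  intro g hg
  have ev : ∀ (k : ASet h d) (u : Fin (h + 1) → ℕ) (hu : ∀ e, u e ≤ (k.1 e).1),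
      g (Sum.inl k) * zeta2d d ^ (∑ e, u e) +
        (if hk : ∃ e, μ ≤ e.1 ∧ (k.1 e).1 ≠ 0 then
          g (Sum.inr ⟨k, hk⟩) * zeta2d d ^ (∑ e, u e * (1 + 2 * aμ h μ e)) else 0) = 0 := by
    intro k u hu
    have h1 := congrFun hg (liftIdx h d k u hu)
    rw [Fintype.sum_sum_type] at h1
    simp only [Matrix.row, cmat, Matrix.of_apply, Sum.elim_inl, Sum.elim_inr, Pi.add_apply,
      Finset.sum_apply, Pi.smul_apply, smul_eq_mul, nmat_liftIdx, Pi.zero_apply] at h1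
    refine Eq.trans ?_ h1
    congr 1
    · simp
    · split_ifs with hk
      · rw [Finset.sum_eq_single (⟨k, hk⟩ : BSet h d μ)]
        · simp
        · intro b _ hb
          rw [if_neg (fun hx => hb (Subtype.ext hx)), mul_zero]
        · simp
      · refine (Finset.sum_eq_zero fun b _ => ?_).symm
        rw [if_neg, mul_zero]
        rintro rfl
        exact hk b.2
  have hB : ∀ k : BSet h d μ, g (Sum.inr k) = 0 := by
    rintro ⟨k, hk⟩
    have h0 := ev k (fun _ => 0) (fun _ => Nat.zero_le _)
    rw [dif_pos hk] at h0
    simp only [Finset.sum_const_zero, zero_mul, pow_zero, mul_one] at h0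
    obtain ⟨e, he, hke⟩ := hk
    have h1 := ev k (fun x => if x = e then 1 else 0) (fun x => by
      split_ifs with hx
      · subst hx; omega
      · omega)
    rw [dif_pos ⟨e, he, hke⟩] at h1
    simp only [ite_mul, one_mul, zero_mul, Finset.sum_ite_eq', Finset.mem_univ, if_true, aμ,
      if_neg (not_lt.mpr he)] at h1
    have h2 : g (Sum.inr ⟨k, ⟨e, he, hke⟩⟩) * (zeta2d d * (zeta2d d ^ 2 - 1)) = 0 := by
      linear_combination h1 - zeta2d d * h0
    exact (mul_eq_zero.mp h2).resolve_right
      (mul_ne_zero (zeta_ne d) (sub_ne_zero.mpr (zeta_sq_ne d hd)))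
  rintro (k | k)
  · have h0 := ev k (fun _ => 0) (fun _ => Nat.zero_le _)
    simpa [hB] using h0
  · exact hB k

lemma card_BSet (h d μ : ℕ) (hd : 3 ≤ d) (hμ : μ ≤ h + 1) :
    Fintype.card (BSet h d μ) + tupCount d μ = tupCount d (h + 1) := by
  have := Nat.card_congr (Equiv.sumCompl (fun k : ASet h d => ∃ e, μ ≤ e.1 ∧ (k.1 e).1 ≠ 0))
  rw [Nat.card_sum] at this
  rw [← card_zero_tail d (h + 1) μ hd hμ, tupCount]
  simp only [← Nat.card_eq_fintype_card]
  exact this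

/-- For `nd ≥ 2n+4` and `−1 ≤ m ≤ n/2` (here `μ = m+1`, `n = 2h`), the codimension in
`ℂ^{I_d}` of `ker[P_{i+j}] ∩ ker[(P̌_m)_{i+j}]` equals `K^d_n(m)`; in particular, for
`m = −1` (`μ = 0`) the kernels intersect transversely: the codimension equals the sum
of the two ranks. -/
theorem codim_inter_kernels (h d : ℕ) (hh : 1 ≤ h) (hd : 3 ≤ d)
    (hnd : 2 * (2 * h) + 4 ≤ (2 * h) * d) (μ : ℕ) (hμ : μ ≤ h + 1) :
    ((Module.finrank ℂ ((IdxSet h d d → ℂ) ⧸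
        (LinearMap.ker (pmat h d (Pvec h d)).mulVecLin ⊓
          LinearMap.ker (pmat h d (PcheckVec h d μ)).mulVecLin)) : ℤ) = Kdef h d μ) ∧
    (μ = 0 →
      Module.finrank ℂ ((IdxSet h d d → ℂ) ⧸
        (LinearMap.ker (pmat h d (Pvec h d)).mulVecLin ⊓
          LinearMap.ker (pmat h d (PcheckVec h d μ)).mulVecLin))
        = (pmat h d (Pvec h d)).rank + (pmat h d (PcheckVec h d μ)).rank) := by
  have hhd : 2 * h + 2 ≤ h * d := by nlinarith
  have hP := ker_pmat h d hd hhd (fun _ => 0)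
  have hQ := ker_pmat h d hd hhd (aμ h μ)
  have e1 : Pvec h d = pvec h d (fun _ => 0) (Equiv.refl _) := rfl
  have e2 : PcheckVec h d μ = pvec h d (aμ h μ) (Equiv.refl _) := rfl
  have hc := card_BSet h d μ hd hμ
  have hrank : ∀ a : Fin (h + 1) → ℕ,
      (pmat h d (pvec h d a (Equiv.refl _))).rank = tupCount d (h + 1) := by
    intro a
    rw [← rank_nmat h d a, ← finrank_quot_ker, ← finrank_quot_ker, ker_pmat h d hd hhd a]
  rw [e1, e2, hrank, hrank, hP, hQ, ker_cmat, finrank_quot_ker, rank_cmat h d μ hd]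
  constructor
  · rw [Kdef, Ccoef_twoBlock h d _ _ (by omega), Ccoef_twoBlock h d _ _ (by omega)]
    push_cast
    omega
  · rintro rfl
    have h0 : tupCount d 0 = 0 := by
      rw [tupCount, Fintype.card_eq_zero_iff]
      refine ⟨fun k => ?_⟩
      have := k.2
      simp at this
      omega
    omega
end

section
/- For (n,d) = (12,3) and every m ∈ {−1, 0, 1, 2}, the rank of the matrix [P_{i+j}] + [(P̌_m)_{i+j}] equals K^3_{12}(m) := 2·C_{1^{7},2^{7}} − C_{1^{12−m+1},2^{m+1}}. -/
open Finset Matrix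

namespace CubicTwelve

lemma zeta_prim : IsPrimitiveRoot (zeta2d 3) 6 := by
  have h := Complex.isPrimitiveRoot_exp 6 (by norm_num)
  have e : zeta2d 3 = Complex.exp (2 * Real.pi * Complex.I / ((6 : ℕ) : ℂ)) := by
    unfold zeta2d; congr 1; push_cast; norm_num
  rw [e]; exact h

lemma zeta_ne : zeta2d 3 ≠ 0 := Complex.exp_ne_zero _

lemma zeta_cube : zeta2d 3 ^ 3 = -1 := by
  have h6 : zeta2d 3 ^ 6 = 1 := zeta_prim.pow_eq_one
  have h3 : zeta2d 3 ^ 3 ≠ 1 := zeta_prim.pow_ne_one_of_pos_of_lt (by norm_num) (by norm_num)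
  have : (zeta2d 3 ^ 3 - 1) * (zeta2d 3 ^ 3 + 1) = 0 := by linear_combination h6
  rcases mul_eq_zero.1 this with h | h
  · exact absurd (sub_eq_zero.1 h) h3
  · exact eq_neg_of_add_eq_zero_left h

lemma zeta_add : 1 + zeta2d 3 ≠ 0 := by
  intro h
  have h2 : zeta2d 3 ^ 2 ≠ 1 := zeta_prim.pow_ne_one_of_pos_of_lt (by norm_num) (by norm_num)
  apply h2
  linear_combination (zeta2d 3 - 1) * h

lemma sum14 (f : Fin (2 * 6 + 2) → ℕ) :
    ∑ k, f k = ∑ e : Fin (6 + 1), (f (evIdx 6 e) + f (odIdx 6 e)) := by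
  have h1 : ∑ k, f k = ∑ k : Fin 14, f k := rfl
  have h2 : ∑ e : Fin (6 + 1), (f (evIdx 6 e) + f (odIdx 6 e))
      = ∑ e : Fin 7, (f (evIdx 6 e) + f (odIdx 6 e)) := rfl
  rw [h1, h2]
  simp only [Fin.sum_univ_succ, Fin.sum_univ_zero, evIdx, odIdx]
  simp only [Fin.succ, Fin.val_zero]
  simp [Fin.ext_iff]
  ring_nf
  try rfl

/-- The tuple `i` is supported on the pairs of `S`, once in each of these pairs. -/
def Good (i : Fin (2 * 6 + 2) → Fin (3 - 1)) (S : Finset (Fin (6 + 1))) : Prop :=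
  ∀ e, (i (evIdx 6 e)).1 + (i (odIdx 6 e)).1 = if e ∈ S then 1 else 0

instance (i S) : Decidable (Good i S) := by unfold Good; infer_instance

/-- partial tensor monomial. -/
noncomputable def W (a : Fin (6 + 1) → ℕ) (S : Finset (Fin (6 + 1)))
    (i : Fin (2 * 6 + 2) → Fin (3 - 1)) : ℂ :=
  if Good i S then ∏ e ∈ S, zeta2d 3 ^ (((i (evIdx 6 e)).1 + 1) * (1 + 2 * a e)) else 0

/-- Test tuple: supported on the pairs of `S`, even position exactly for `e ∈ F`. -/
def mk (S F : Finset (Fin (6 + 1))) : Fin (2 * 6 + 2) → Fin (3 - 1) := fun k =>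
  if (⟨k.1 / 2, by omega⟩ : Fin (6 + 1)) ∈ S then
    if k.1 % 2 = 0 then (if (⟨k.1 / 2, by omega⟩ : Fin (6 + 1)) ∈ F then 1 else 0)
    else (if (⟨k.1 / 2, by omega⟩ : Fin (6 + 1)) ∈ F then 0 else 1)
  else 0

lemma mk_ev (S F e) : mk S F (evIdx 6 e) = if e ∈ S then (if e ∈ F then 1 else 0) else 0 := by
  have h : 2 * e.1 / 2 = e.1 := by omega
  simp [mk, evIdx]

lemma mk_od (S F e) : mk S F (odIdx 6 e) = if e ∈ S then (if e ∈ F then 0 else 1) else 0 := by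
  have h : (2 * e.1 + 1) / 2 = e.1 := by omega
  have h' : (2 * e.1 + 1) % 2 = 1 := by omega
  simp [mk, odIdx, h]

lemma mk_good (S F S') : Good (mk S F) S' ↔ S' = S := by
  have key : ∀ e, (mk S F (evIdx 6 e)).1 + (mk S F (odIdx 6 e)).1 = if e ∈ S then 1 else 0 := by
    intro e
    rw [mk_ev, mk_od]
    by_cases h1 : e ∈ S <;> by_cases h2 : e ∈ F <;> simp [h1, h2]
  constructor
  · intro h
    ext e
    have := (h e).symm.trans (key e)
    by_cases h1 : e ∈ S <;> by_cases h2 : e ∈ S' <;> simp_all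
  · rintro rfl
    exact key

lemma mk_sum (S F) : ∑ k, (mk S F k).1 = S.card := by
  rw [sum14 (fun k => (mk S F k).1)]
  have := (mk_good S F S).2 rfl
  rw [Finset.sum_congr rfl (fun e _ => this e)]
  simp

lemma good_card {i S} (h : Good i S) : ∑ k, (i k).1 = S.card := by
  rw [sum14 (fun k => (i k).1)]
  rw [Finset.sum_congr rfl (fun e _ => h e)]
  simp

lemma good_unique {i S S'} (h : Good i S) (h' : Good i S') : S = S' := by
  ext e
  have := (h e).symm.trans (h' e)
  by_cases h1 : e ∈ S <;> by_cases h2 : e ∈ S' <;> simp_all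

lemma W_ne (a S F) : W a S (mk S F) ≠ 0 := by
  rw [W, if_pos ((mk_good S F S).2 rfl)]
  exact Finset.prod_ne_zero_iff.2 fun e _ => pow_ne_zero _ zeta_ne

lemma W_other (a S S' F) (h : S' ≠ S) : W a S' (mk S F) = 0 := by
  rw [W, if_neg]
  rwa [mk_good]

lemma W_flip (a S e0) (he : e0 ∈ S) :
    W a S (mk S {e0}) = zeta2d 3 ^ (1 + 2 * a e0) * W a S (mk S ∅) := by
  rw [W, W, if_pos ((mk_good S _ S).2 rfl), if_pos ((mk_good S _ S).2 rfl)]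
  rw [← Finset.mul_prod_erase _ _ he, ← Finset.mul_prod_erase S
    (fun e => zeta2d 3 ^ (((mk S ∅ (evIdx 6 e)).1 + 1) * (1 + 2 * a e))) he, ← mul_assoc]
  congr 1
  · rw [mk_ev, mk_ev]
    simp [he]
    ring
  · apply Finset.prod_congr rfl
    intro e h
    rw [mk_ev, mk_ev]
    simp [Finset.ne_of_mem_erase h]

/-- exponents of the second cycle -/
def aa (μ : ℕ) : Fin (6 + 1) → ℕ := fun e => if e.1 < μ then 0 else 1

abbrev Sub (μ : ℕ) (T : Finset (Fin (6 + 1))) : Prop := ∀ e ∈ T, e.1 < μ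

lemma W_sub (μ T i) (h : Sub μ T) : W (aa μ) T i = W (fun _ => 0) T i := by
  unfold W
  congr 1
  apply Finset.prod_congr rfl
  intro e he
  simp [aa, h e he]

abbrev T3 : Type := {T : Finset (Fin (6 + 1)) // T.card = 3}
abbrev T3' (μ : ℕ) : Type := {T : Finset (Fin (6 + 1)) // T.card = 3 ∧ ¬ Sub μ T}

noncomputable def A (μ : ℕ) : Matrix (IdxSet 6 3 (6 * 3 - (2 * 6 + 2))) (T3 ⊕ T3' μ) ℂ :=
  Matrix.of fun i k => match k with
    | .inl T => W (fun _ => 0) T.1ᶜ i.1 + if Sub μ T.1 then W (aa μ) T.1ᶜ i.1 else 0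
    | .inr T => W (aa μ) T.1ᶜ i.1

noncomputable def B (μ : ℕ) : Matrix (T3 ⊕ T3' μ) (IdxSet 6 3 3) ℂ :=
  Matrix.of fun k j => match k with
    | .inl T => W (fun _ => 0) T.1 j.1
    | .inr T => W (aa μ) T.1 j.1

lemma pvec_good (a : Fin (6 + 1) → ℕ) (i j T) (hi : Good i Tᶜ) (hj : Good j T) :
    pvec 6 3 a (Equiv.refl _) (fun e => (i e).1 + (j e).1) = W a Tᶜ i * W a T j := by
  rw [pvec, if_pos, W, if_pos hi, W, if_pos hj, ← Finset.prod_pow_eq_pow_sum,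
    ← Finset.prod_compl_mul_prod T]
  · congr 1
    · apply Finset.prod_congr rfl
      intro e he
      have h := hj e
      rw [if_neg (Finset.mem_compl.1 he)] at h
      have : (j (evIdx 6 e)).1 = 0 := by omega
      simp [this]
    · apply Finset.prod_congr rfl
      intro e he
      have h := hi e
      rw [if_neg (by simpa using he)] at h
      have : (i (evIdx 6 e)).1 = 0 := by omega
      simp [this]
  · intro e
    have h1 := hi e
    have h2 := hj e
    by_cases he : e ∈ T <;> simp [he] at h1 h2 ⊢ <;> omega

lemma pvec_bad (a : Fin (6 + 1) → ℕ) (i j) (h : ¬ ∃ T, Good i Tᶜ ∧ Good j T) :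
    pvec 6 3 a (Equiv.refl _) (fun e => (i e).1 + (j e).1) = 0 := by
  rw [pvec, if_neg]
  intro H
  apply h
  refine ⟨Finset.univ.filter fun e => (j (evIdx 6 e)).1 + (j (odIdx 6 e)).1 = 1, ?_, ?_⟩
  all_goals
    intro e
    have := H e
    simp only [Equiv.refl_apply] at this
    simp only [Finset.mem_compl, Finset.mem_filter, Finset.mem_univ, true_and]
    split_ifs <;> omega

lemma factor (μ : ℕ) :
    pmat 6 3 (Pvec 6 3) + pmat 6 3 (PcheckVec 6 3 μ) = A μ * B μ := by
  ext i j
  rw [Matrix.mul_apply, Fintype.sum_sum_type]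
  simp only [Matrix.add_apply, pmat, Matrix.of_apply, Pvec, PcheckVec, A, B]
  change pvec 6 3 _ _ _ + pvec 6 3 (aa μ) _ _ = _
  by_cases h : ∃ T, Good i.1 Tᶜ ∧ Good j.1 T
  · obtain ⟨T, hi, hj⟩ := h
    have hT : T.card = 3 := (good_card hj).symm.trans j.2
    rw [pvec_good _ _ _ T hi hj, pvec_good _ _ _ T hi hj]
    have hz : ∀ a T', T' ≠ T → W a T' j.1 = 0 := fun a T' hne => by
      rw [W, if_neg]
      exact fun hg => hne (good_unique hg hj)
    rw [Fintype.sum_eq_single (⟨T, hT⟩ : T3)]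
    swap
    · intro T' hne
      rw [hz _ T'.1 (fun h => hne (Subtype.ext h)), mul_zero]
    by_cases hs : Sub μ T
    · rw [Fintype.sum_eq_zero]
      · simp only [if_pos hs, W_sub μ T _ hs]
        ring
      · intro T'
        rw [hz _ T'.1 (fun h => T'.2.2 (h ▸ hs)), mul_zero]
    · rw [Fintype.sum_eq_single (⟨T, hT, hs⟩ : T3' μ)]
      · simp only [if_neg hs]
        ring
      · intro T' hne
        rw [hz _ T'.1 (fun h => hne (Subtype.ext h)), mul_zero]
  · rw [pvec_bad _ _ _ h, pvec_bad _ _ _ h]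
    have hz : ∀ a b T', W a T'ᶜ i.1 * W b T' j.1 = 0 := fun a b T' => by
      by_cases h1 : Good i.1 T'ᶜ
      · have h2 : ¬ Good j.1 T' := fun h2 => h ⟨T', h1, h2⟩
        rw [W, W, if_neg h2, mul_zero]
      · rw [W, if_neg h1, zero_mul]
    rw [Fintype.sum_eq_zero, Fintype.sum_eq_zero, add_zero]
    · intro T'
      exact hz _ _ _
    · intro T'
      rw [add_mul, hz, zero_add]
      split_ifs
      · exact hz _ _ _
      · rw [zero_mul]

lemma two_solve (x y u w : ℂ) (hu : u ≠ 0) (hw : w ≠ 0) (h1 : x * u + y * w = 0)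
    (h2 : x * (zeta2d 3 * u) - y * w = 0) : x = 0 ∧ y = 0 := by
  have hx : x = 0 := by
    have : (1 + zeta2d 3) * u * x = 0 := by linear_combination h1 + h2
    simpa [zeta_add, hu] using this
  refine ⟨hx, ?_⟩
  subst hx
  simpa [hw] using h1

lemma flip0 (S e0) (he : e0 ∈ S) :
    W (fun _ => 0) S (mk S {e0}) = zeta2d 3 * W (fun _ => 0) S (mk S ∅) := by
  rw [W_flip _ _ _ he]; simp

lemma flip1 (μ S e0) (he : e0 ∈ S) (h : ¬ e0.1 < μ) :
    W (aa μ) S (mk S {e0}) = - W (aa μ) S (mk S ∅) := by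
  rw [W_flip _ _ _ he]; simp [aa, h, zeta_cube]

lemma sum_pick (μ : ℕ) (g : T3 ⊕ T3' μ → ℂ) (T : T3) (f0 : T3 → ℂ) (f1 : T3' μ → ℂ)
    (h0 : ∀ T', T' ≠ T → f0 T' = 0) (h1 : ∀ T', T'.1 ≠ T.1 → f1 T' = 0)
    (h : ∑ T', g (.inl T') * f0 T' + ∑ T', g (.inr T') * f1 T' = 0) :
    (∀ hs : ¬ Sub μ T.1, g (.inl T) * f0 T + g (.inr ⟨T.1, T.2, hs⟩) * f1 ⟨T.1, T.2, hs⟩ = 0) ∧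
    (Sub μ T.1 → g (.inl T) * f0 T = 0) := by
  rw [Fintype.sum_eq_single T (fun T' hne => by rw [h0 _ hne, mul_zero])] at h
  constructor
  · intro hs
    rwa [Fintype.sum_eq_single (⟨T.1, T.2, hs⟩ : T3' μ) (fun T' hne => by
      rw [h1 _ (fun h => hne (Subtype.ext h)), mul_zero])] at h
  · intro hs
    rwa [Fintype.sum_eq_zero _ (fun T' => by
      rw [h1 _ (fun h => T'.2.2 (h ▸ hs)), mul_zero]), add_zero] at h

lemma all_zero (μ : ℕ) (g : T3 ⊕ T3' μ → ℂ)
    (h : ∀ T : T3, g (.inl T) = 0 ∧ ∀ hs : ¬ Sub μ T.1, g (.inr ⟨T.1, T.2, hs⟩) = 0) : g = 0 := by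
  funext k
  rcases k with T | T
  · exact (h T).1
  · exact (h ⟨T.1, T.2.1⟩).2 T.2.2

lemma B_indep (μ : ℕ) : LinearIndependent ℂ (B μ).row := by
  rw [Fintype.linearIndependent_iff]
  intro g hg
  apply congrFun
  apply all_zero
  intro T
  have key : ∀ F, _ := fun F => sum_pick μ g T (fun T' => W (fun _ => 0) T'.1 (mk T.1 F))
    (fun T' => W (aa μ) T'.1 (mk T.1 F))
    (fun T' hne => W_other _ _ _ _ (fun h => hne (Subtype.ext h)))
    (fun T' hne => W_other _ _ _ _ hne)
    (by
      have := congrFun hg ⟨mk T.1 F, by rw [mk_sum, T.2]⟩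
      rw [Fintype.sum_sum_type] at this
      simpa [B, Matrix.row, Finset.sum_apply] using this)
  by_cases hs : Sub μ T.1
  · have := (key ∅).2 hs
    refine ⟨?_, fun h => absurd hs h⟩
    simpa [W_ne] using this
  · have hs' := hs
    unfold Sub at hs'
    push Not at hs'
    obtain ⟨e0, he, hlt⟩ := hs'
    have k1 := (key ∅).1 hs
    have k2 := (key {e0}).1 hs
    simp only at k1 k2
    rw [flip0 _ _ he, flip1 _ _ _ he (by omega)] at k2
    have := two_solve _ _ _ _ (W_ne _ _ _) (W_ne _ _ _) k1 (by linear_combination k2)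
    exact ⟨this.1, fun _ => this.2⟩

lemma A_inj (μ : ℕ) (hμ : μ ≤ 3) (g : T3 ⊕ T3' μ → ℂ) (hg : A μ *ᵥ g = 0) : g = 0 := by
  apply all_zero
  intro T
  have hc : T.1ᶜ.card = 4 := by rw [Finset.card_compl, T.2]; rfl
  have hne : ∀ T' : Finset (Fin (6 + 1)), T' ≠ T.1 → T'ᶜ ≠ T.1ᶜ :=
    fun T' h h' => h (compl_injective h')
  have key : ∀ F, _ := fun F => sum_pick μ g T
    (fun T' => W (fun _ => 0) T'.1ᶜ (mk T.1ᶜ F) + if Sub μ T'.1 then W (aa μ) T'.1ᶜ (mk T.1ᶜ F) else 0)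
    (fun T' => W (aa μ) T'.1ᶜ (mk T.1ᶜ F))
    (fun T' h => by
      have := hne T'.1 (fun h' => h (Subtype.ext h'))
      rw [W_other _ _ _ _ this, W_other _ _ _ _ this]
      simp)
    (fun T' h => W_other _ _ _ _ (hne _ h))
    (by
      have := congrFun hg ⟨mk T.1ᶜ F, by rw [mk_sum, hc]⟩
      rw [Matrix.mulVec, dotProduct, Fintype.sum_sum_type] at this
      simp only [A, Matrix.of_apply, Pi.zero_apply] at this
      refine Eq.trans ?_ this
      congr 1 <;> exact Finset.sum_congr rfl fun _ _ => mul_comm _ _)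
  obtain ⟨e0, he, hlt⟩ : ∃ e0 ∈ T.1ᶜ, ¬ e0.1 < μ := by
    by_contra! hcon
    have hsub : T.1ᶜ ⊆ Finset.univ.filter (fun e : Fin (6 + 1) => e.1 < 3) := by
      intro e he
      simp only [Finset.mem_filter, Finset.mem_univ, true_and]
      have := hcon e he
      omega
    have := Finset.card_le_card hsub
    rw [hc] at this
    exact absurd this (by decide)
  by_cases hs : Sub μ T.1
  · have k1 := (key ∅).2 hs
    have k2 := (key {e0}).2 hs
    simp only [if_pos hs] at k1 k2
    rw [flip0 _ _ he, flip1 _ _ _ he hlt] at k2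
    have := two_solve _ _ _ _ (W_ne _ _ _) (W_ne _ _ _) ((mul_add _ _ _).symm.trans k1)
      (by linear_combination k2)
    exact ⟨this.1, fun h => absurd hs h⟩
  · have k1 := (key ∅).1 hs
    have k2 := (key {e0}).1 hs
    simp only [if_neg hs, add_zero] at k1 k2
    rw [flip0 _ _ he, flip1 _ _ _ he hlt] at k2
    have := two_solve _ _ _ _ (W_ne _ _ _) (W_ne _ _ _) k1 (by linear_combination k2)
    exact ⟨this.1, fun _ => this.2⟩

lemma rank_eq (μ : ℕ) (hμ : μ ≤ 3) :
    (pmat 6 3 (Pvec 6 3) + pmat 6 3 (PcheckVec 6 3 μ)).rank = Fintype.card (T3 ⊕ T3' μ) := by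
  rw [factor, ← (B_indep μ).rank_matrix]
  apply le_antisymm (Matrix.rank_mul_le_right _ _)
  have hinj : Function.Injective (A μ).mulVec := by
    intro x y hxy
    apply sub_eq_zero.1
    apply A_inj μ hμ
    rw [Matrix.mulVec_sub, sub_eq_zero]
    exact hxy
  obtain ⟨l, hl⟩ := (A μ).mulVecLin.exists_leftInverse_of_injective (LinearMap.ker_eq_bot.2 hinj)
  obtain ⟨L, hL⟩ : ∃ L : Matrix (T3 ⊕ T3' μ) (IdxSet 6 3 (6 * 3 - (2 * 6 + 2))) ℂ, L * A μ = 1 := by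
    refine ⟨LinearMap.toMatrix' l, ?_⟩
    have := congrArg LinearMap.toMatrix' hl
    rwa [LinearMap.toMatrix'_comp, ← Matrix.toLin'_apply', LinearMap.toMatrix'_toLin', LinearMap.toMatrix'_id] at this
  calc (B μ).rank = (L * (A μ * B μ)).rank := by rw [← Matrix.mul_assoc, hL, Matrix.one_mul]
    _ ≤ _ := Matrix.rank_mul_le_right _ _

lemma Ccoef_eq (n s : ℕ) (hs : 3 ≤ s) (α : Fin s → ℕ) (hα : ∀ i, 1 ≤ α i) :
    Ccoef n 3 α = ((n + 1 + 3).choose (n + 1) : ℤ) -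
      ∑ k ∈ Finset.Icc 1 3, (-1 : ℤ) ^ (k - 1) *
        ∑ T ∈ Finset.powersetCard k (Finset.univ : Finset (Fin s)),
          if ∑ i ∈ T, α i ≤ 3 then (((n + 1 + 3 - ∑ i ∈ T, α i).choose (n + 1) : ℤ)) else 0 := by
  unfold Ccoef
  congr 1
  symm
  rw [← Finset.sum_subset (Finset.Icc_subset_Icc_right hs)]
  · apply Finset.sum_congr rfl
    intro k _
    rw [← Finset.sum_filter]
    congr 2
    ext T
    simp [Finset.mem_powersetCard]
  · intro k hk hk'
    rw [Finset.filter_eq_empty_iff.2]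
    · simp
    · rintro T - ⟨h1, h2⟩
      have : T.card ≤ ∑ i ∈ T, α i := by
        simpa using Finset.card_nsmul_le_sum T α 1 (fun i _ => hα i)
      simp at hk hk'
      omega

lemma K_val : ∀ μ : Fin 4, Kdef 6 3 μ.1 = 70 - if μ.1 = 3 then 1 else 0 := by
  have h1 : ∀ s t : ℕ, ∀ i, 1 ≤ twoBlock 1 (3 - 1) s t i := by
    intro s t i; unfold twoBlock; split_ifs <;> omega
  intro μ
  unfold Kdef
  rw [Ccoef_eq _ _ (by omega) _ (h1 _ _), Ccoef_eq _ _ (by omega) _ (h1 _ _)]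
  revert μ
  decide +kernel

lemma card_val : ∀ μ : Fin 4, Fintype.card (T3 ⊕ T3' μ.1) = 70 - if μ.1 = 3 then 1 else 0 := by
  decide +kernel

end CubicTwelve

/-- For `(n,d) = (12,3)` (so `h = 6`) and every `m ∈ {−1,0,1,2}` (i.e. `μ = m+1 ≤ 3`),
the rank of `[P_{i+j}] + [(P̌_m)_{i+j}]` equals `K^3_{12}(m)`. -/
theorem rank_sum_cubic_twelvefold (μ : ℕ) (hμ : μ ≤ 3) :
    (((pmat 6 3 (Pvec 6 3) + pmat 6 3 (PcheckVec 6 3 μ)).rank : ℤ)) = Kdef 6 3 μ := by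
  rw [CubicTwelve.rank_eq μ hμ]
  have h1 := CubicTwelve.K_val ⟨μ, by omega⟩
  have h2 := CubicTwelve.card_val ⟨μ, by omega⟩
  simp only at h1 h2
  rw [h1, h2]
  split_ifs <;> norm_num
end
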